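/- arXiv:1705.06438 — 4 statements merged into one kernel-verified Lean document; each statement's English description precedes it below -/
import Mathlib

section
/- Let d ≥ 1 and let D : ℝ^{d×d} × ℝ^{d×d} → [0,∞) satisfy: D(F₁,F₂) = D(F₂,F₁) for all F₁,F₂; D(F,F) = 0 for all F in a neighborhood of Id; D(Q₁F₁, Q₂F₂) = D(F₁,F₂) for all rotations Q₁,Q₂ ∈ SO(d) and all F₁,F₂ in a neighborhood of Id; and D² is twice differentiable at (Id,Id). Then for all F₁,F₂ ∈ ℝ^{d×d}, the Hessian of D² at (Id,Id) satisfies ∂²D²(Id,Id)[(F₁,F₂),(F₁,F₂)] = ∂²_{F₁²}D²(Id,Id)[sym(F₁−F₂), sym(F₁−F₂)], i.e. it only depends on the symmetric part of F₁−F₂. Here sym(F) := (F + Fᵀ)/2. -/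
open Matrix Filter Topology

attribute [local instance] Matrix.frobeniusNormedAddCommGroup Matrix.frobeniusNormedSpace

section RotationCurve

attribute [local instance] Matrix.frobeniusNormedRing Matrix.frobeniusNormedAlgebra

/-- Every skew-symmetric matrix is the velocity at the identity of a curve of rotations. -/
theorem Matrix.exists_rotation_curve_of_transpose_eq_neg {n : Type*} [Fintype n] [DecidableEq n]
    {A : Matrix n n ℝ} (hA : Aᵀ = -A) :
    ∃ γ : ℝ → Matrix n n ℝ, γ 0 = 1 ∧ HasDerivAt γ A 0 ∧
      ∀ t, (γ t)ᵀ * γ t = 1 ∧ (γ t).det = 1 := by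
  have horth (t : ℝ) : (NormedSpace.exp (t • A))ᵀ * NormedSpace.exp (t • A) = 1 := by
    rw [← Matrix.exp_transpose, Matrix.transpose_smul, hA, smul_neg, Matrix.exp_neg]
    exact Matrix.nonsing_inv_mul _ ((Matrix.isUnit_iff_isUnit_det _).1 (Matrix.isUnit_exp _))
  refine ⟨fun t => NormedSpace.exp (t • A), by simp, ?_, fun t => ⟨horth t, ?_⟩⟩
  · have h := hasDerivAt_exp_smul_const (𝕂 := ℝ) A (0 : ℝ)
    rw [zero_smul, NormedSpace.exp_zero, one_mul] at h
    exact h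
  · have hhalf : t • A = (t / 2) • A + (t / 2) • A := by rw [← add_smul, add_halves]
    have hdet := congrArg Matrix.det (horth (t / 2))
    rw [Matrix.det_mul, Matrix.det_transpose, Matrix.det_one] at hdet
    beta_reduce
    rw [hhalf, Matrix.exp_add_of_commute _ _ (Commute.refl _), Matrix.det_mul, hdet]

end RotationCurve

/-- If `f'` vanishes along a curve through `x`, then `f''` at `x` vanishes on its velocity. -/
theorem fderiv_fderiv_apply_eq_zero_of_curve {E : Type*} [NormedAddCommGroup E] [NormedSpace ℝ E]
    {f : E → ℝ} {x v : E} {γ : ℝ → E} (hf : DifferentiableAt ℝ (fderiv ℝ f) x)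
    (hx : γ 0 = x) (hγ : HasDerivAt γ v 0) (h0 : ∀ᶠ t in 𝓝 0, fderiv ℝ f (γ t) = 0) :
    fderiv ℝ (fderiv ℝ f) x v = 0 := by
  subst hx
  have h := hf.hasFDerivAt.comp_hasDerivAt (0 : ℝ) hγ
  have hconst : HasDerivAt (fderiv ℝ f ∘ γ) (0 : E →L[ℝ] ℝ) 0 :=
    (hasDerivAt_const (0 : ℝ) (0 : E →L[ℝ] ℝ)).congr_of_eventuallyEq h0
  exact h.unique hconst

/-- The second derivative of a partial map is the restriction of the full second derivative. -/
theorem fderiv_fderiv_partial_fst {E F : Type*} [NormedAddCommGroup E] [NormedSpace ℝ E]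
    [NormedAddCommGroup F] [NormedSpace ℝ F] {g : E × F → ℝ} {x : E} {y : F}
    (hg : ∀ᶠ p in 𝓝 (x, y), DifferentiableAt ℝ g p)
    (hg' : DifferentiableAt ℝ (fderiv ℝ g) (x, y)) (v w : E) :
    fderiv ℝ (fderiv ℝ fun z => g (z, y)) x v w =
      fderiv ℝ (fderiv ℝ g) (x, y) (v, 0) (w, 0) := by
  have hcont : Tendsto (fun z : E => (z, y)) (𝓝 x) (𝓝 (x, y)) :=
    (Continuous.prodMk_left y).tendsto x
  have hev : fderiv ℝ (fun z => g (z, y)) =ᶠ[𝓝 x]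
      fun z => (fderiv ℝ g (z, y)).comp (ContinuousLinearMap.inl ℝ E F) := by
    filter_upwards [hcont.eventually hg] with z hz
    exact (hz.hasFDerivAt.comp z (hasFDerivAt_prodMk_left z y)).fderiv
  have hcomp : HasFDerivAt (fun z : E => fderiv ℝ g (z, y)) _ x :=
    hg'.hasFDerivAt.comp x (hasFDerivAt_prodMk_left x y)
  have h := hcomp.clm_comp (hasFDerivAt_const (ContinuousLinearMap.inl ℝ E F) x)
  rw [hev.fderiv_eq, HasFDerivAt.fderiv h]
  simp

/-- A symmetric bilinear form is unchanged on adding an element of its kernel. -/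
theorem apply_self_eq_of_eq_add {E : Type*} [NormedAddCommGroup E] [NormedSpace ℝ E]
    {B : E →L[ℝ] E →L[ℝ] ℝ} (hB : ∀ v w, B v w = B w v) {v w z : E} (hz : B z = 0)
    (hv : v = w + z) : B v v = B w w := by
  have hwz : B w z = 0 := by simp [hB w z, hz]
  simp [hv, hz, hwz]

/-- For a symmetric nonnegative dissipation distance `D` vanishing on the
diagonal near the identity and separately frame indifferent near the identity, the Hessian of
`D²` at `(Id, Id)` only depends on the symmetric part of `F₁ - F₂`. -/
theorem hessian_of_squared_distance_sym_part
    (d : ℕ) (hd : 1 ≤ d)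
    (D : Matrix (Fin d) (Fin d) ℝ → Matrix (Fin d) (Fin d) ℝ → ℝ)
    (hDnonneg : ∀ F₁ F₂, 0 ≤ D F₁ F₂)
    (hDsymm : ∀ F₁ F₂, D F₁ F₂ = D F₂ F₁)
    (U : Set (Matrix (Fin d) (Fin d) ℝ))
    (hU : U ∈ 𝓝 (1 : Matrix (Fin d) (Fin d) ℝ))
    (hdiag : ∀ F ∈ U, D F F = 0)
    (V : Set (Matrix (Fin d) (Fin d) ℝ))
    (hV : V ∈ 𝓝 (1 : Matrix (Fin d) (Fin d) ℝ))
    (hframe : ∀ Q₁ Q₂ : Matrix (Fin d) (Fin d) ℝ,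
      Q₁ᵀ * Q₁ = 1 → Q₁.det = 1 → Q₂ᵀ * Q₂ = 1 → Q₂.det = 1 →
      ∀ F₁ ∈ V, ∀ F₂ ∈ V, D (Q₁ * F₁) (Q₂ * F₂) = D F₁ F₂)
    (g : Matrix (Fin d) (Fin d) ℝ × Matrix (Fin d) (Fin d) ℝ → ℝ)
    (hg : g = fun p => (D p.1 p.2) ^ 2)
    (hdiff : ∀ᶠ p in 𝓝 ((1 : Matrix (Fin d) (Fin d) ℝ), (1 : Matrix (Fin d) (Fin d) ℝ)),
      DifferentiableAt ℝ g p)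
    (hdiff2 : DifferentiableAt ℝ (fderiv ℝ g)
      ((1 : Matrix (Fin d) (Fin d) ℝ), (1 : Matrix (Fin d) (Fin d) ℝ)))
    (F₁ F₂ : Matrix (Fin d) (Fin d) ℝ) :
    fderiv ℝ (fderiv ℝ g) (1, 1) (F₁, F₂) (F₁, F₂)
        = fderiv ℝ (fderiv ℝ (fun F => g (F, 1))) 1
            ((1 / 2 : ℝ) • ((F₁ - F₂) + (F₁ - F₂)ᵀ))
            ((1 / 2 : ℝ) • ((F₁ - F₂) + (F₁ - F₂)ᵀ)) := by
  subst hg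
  set g : Matrix (Fin d) (Fin d) ℝ × Matrix (Fin d) (Fin d) ℝ → ℝ := fun p => (D p.1 p.2) ^ 2
  have hcrit {p} (hp : g p = 0) : fderiv ℝ g p = 0 :=
    IsLocalMin.fderiv_eq_zero (Eventually.of_forall fun q => hp.trans_le (sq_nonneg _))
  have hdiagonal (H : Matrix (Fin d) (Fin d) ℝ) : fderiv ℝ (fderiv ℝ g) (1, 1) (H, H) = 0 := by
    have hline : HasDerivAt (fun t : ℝ => 1 + t • H) H 0 := by
      have h := ((hasDerivAt_id (0 : ℝ)).smul_const H).const_add 1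
      rw [one_smul] at h
      exact h
    refine fderiv_fderiv_apply_eq_zero_of_curve (γ := fun t : ℝ => (1 + t • H, 1 + t • H))
      hdiff2 (by simp) (hline.prodMk hline) ?_
    have hmem : ∀ᶠ t : ℝ in 𝓝 0, 1 + t • H ∈ U :=
      hline.continuousAt.eventually_mem (by rw [zero_smul, add_zero]; exact hU)
    filter_upwards [hmem] with t ht
    exact hcrit (by simp [g, hdiag _ ht])
  have hskew {A : Matrix (Fin d) (Fin d) ℝ} (hA : Aᵀ = -A) :
      fderiv ℝ (fderiv ℝ g) (1, 1) (A, 0) = 0 := by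
    obtain ⟨γ, hγ0, hγ, hrot⟩ := Matrix.exists_rotation_curve_of_transpose_eq_neg hA
    refine fderiv_fderiv_apply_eq_zero_of_curve (γ := fun t : ℝ => (γ t, 1))
      hdiff2 (by simp [hγ0]) (hγ.prodMk (hasDerivAt_const _ _)) (Eventually.of_forall fun t => ?_)
    have hV1 : (1 : Matrix (Fin d) (Fin d) ℝ) ∈ V := mem_of_mem_nhds hV
    have hD := hframe (γ t) 1 (hrot t).1 (hrot t).2 (by simp) (by simp) 1 hV1 1 hV1
    rw [mul_one, mul_one, hdiag 1 (mem_of_mem_nhds hU)] at hD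
    exact hcrit (by simp [g, hD])
  have hsymm (v w) : fderiv ℝ (fderiv ℝ g) (1, 1) v w = fderiv ℝ (fderiv ℝ g) (1, 1) w v :=
    second_derivative_symmetric_of_eventually (hdiff.mono fun p hp => hp.hasFDerivAt)
      hdiff2.hasFDerivAt v w
  have hA : ((1 / 2 : ℝ) • ((F₁ - F₂) - (F₁ - F₂)ᵀ))ᵀ =
      -((1 / 2 : ℝ) • ((F₁ - F₂) - (F₁ - F₂)ᵀ)) := by
    rw [Matrix.transpose_smul, Matrix.transpose_sub, Matrix.transpose_transpose, ← smul_neg,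
      neg_sub]
  refine (apply_self_eq_of_eq_add hsymm (w := (F₁ - F₂, 0)) (hdiagonal F₂) (by simp)).trans
    ((apply_self_eq_of_eq_add hsymm (hskew hA) ?_).trans
      (fderiv_fderiv_partial_fst hdiff hdiff2 _ _).symm)
  rw [Prod.mk_add_mk, add_zero]
  congr 1
  module
end

section
/- Let d ≥ 1, c > 0, and let W : ℝ^{d×d} → [0,∞) satisfy W(F) ≥ c·dist²(F, SO(d)) for all F in a neighborhood of Id, W(Id) = 0, and suppose W is twice differentiable at Id. Then there exists a constant c' > 0 such that the tensor of elastic constants ℂ_W := ∂²W(Id) satisfies ℂ_W[F,F] ≥ c'·|sym(F)|² for all F ∈ ℝ^{d×d}, where sym(F) := (F + Fᵀ)/2 and |·| is the Frobenius norm. -/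
open Matrix Filter Topology

attribute [local instance] Matrix.frobeniusNormedAddCommGroup Matrix.frobeniusNormedSpace

/-- A rotation has the same Frobenius norm as the identity. -/
theorem frobenius_norm_eq_of_transpose_mul_self {n : Type*} [Fintype n] [DecidableEq n]
    {Q : Matrix n n ℝ} (hQ : Qᵀ * Q = 1) : ‖Q‖ = ‖(1 : Matrix n n ℝ)‖ := by
  have key : ∀ A : Matrix n n ℝ, ‖A‖ = Real.sqrt (Aᵀ * A).trace := by
    intro A
    rw [Matrix.frobenius_norm_def, ← Real.sqrt_eq_rpow]
    congr 1
    rw [Finset.sum_comm]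
    simp [Matrix.trace, Matrix.mul_apply, sq]
  rw [key, key, hQ]
  simp

/-- The Frobenius distance to the rotations controls the strain `GᵀG - 1`. -/
theorem norm_transpose_mul_self_sub_one_le {d : ℕ} (G : Matrix (Fin d) (Fin d) ℝ) :
    ‖Gᵀ * G - 1‖ ≤ (‖G‖ + ‖(1 : Matrix (Fin d) (Fin d) ℝ)‖) *
      Metric.infDist G {Q : Matrix (Fin d) (Fin d) ℝ | Qᵀ * Q = 1 ∧ Q.det = 1} := by
  have hne : {Q : Matrix (Fin d) (Fin d) ℝ | Qᵀ * Q = 1 ∧ Q.det = 1}.Nonempty :=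
    ⟨1, by simp⟩
  have hpt : ∀ Q ∈ {Q : Matrix (Fin d) (Fin d) ℝ | Qᵀ * Q = 1 ∧ Q.det = 1},
      ‖Gᵀ * G - 1‖ ≤ (‖G‖ + ‖(1 : Matrix (Fin d) (Fin d) ℝ)‖) * dist G Q := by
    rintro Q ⟨hQ, -⟩
    have h : Gᵀ * G - 1 = Gᵀ * (G - Q) + (G - Q)ᵀ * Q := by
      rw [← hQ, Matrix.transpose_sub, Matrix.mul_sub, Matrix.sub_mul]
      abel
    rw [h, dist_eq_norm, ← frobenius_norm_eq_of_transpose_mul_self hQ]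
    calc ‖Gᵀ * (G - Q) + (G - Q)ᵀ * Q‖
        ≤ ‖Gᵀ‖ * ‖G - Q‖ + ‖(G - Q)ᵀ‖ * ‖Q‖ :=
          (norm_add_le _ _).trans
            (add_le_add (Matrix.frobenius_norm_mul _ _) (Matrix.frobenius_norm_mul _ _))
      _ = (‖G‖ + ‖Q‖) * ‖G - Q‖ := by
          rw [Matrix.frobenius_norm_transpose, Matrix.frobenius_norm_transpose]
          ring
  have hnonneg : 0 ≤ ‖G‖ + ‖(1 : Matrix (Fin d) (Fin d) ℝ)‖ := by positivity
  rcases hnonneg.eq_or_lt with h0 | hpos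
  · obtain ⟨Q, hQ⟩ := hne
    simpa [← h0] using hpt Q hQ
  · rw [← div_le_iff₀' hpos]
    exact (Metric.le_infDist hne).2 fun _ hQ => (div_le_iff₀' hpos).2 (hpt _ hQ)

/-- Second-order expansion along a ray at a critical point where the function vanishes. -/
theorem tendsto_div_sq_of_fderiv_eq_zero {E : Type*} [NormedAddCommGroup E] [NormedSpace ℝ E]
    {f : E → ℝ} {x : E} (hfx : f x = 0) (hf' : fderiv ℝ f x = 0)
    (hf : ∀ᶠ y in 𝓝 x, DifferentiableAt ℝ f y) (hf2 : DifferentiableAt ℝ (fderiv ℝ f) x) (v : E) :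
    Tendsto (fun t : ℝ => f (x + t • v) / t ^ 2) (𝓝[>] 0)
      (𝓝 (fderiv ℝ (fderiv ℝ f) x v v / 2)) := by
  have hline : ∀ t : ℝ, HasDerivAt (fun s : ℝ => x + s • v) v t := fun t => by
    simpa using ((hasDerivAt_id t).smul_const v).const_add x
  have hlim : Tendsto (fun t : ℝ => x + t • v) (𝓝 0) (𝓝 x) := by
    simpa using (hline 0).continuousAt.tendsto
  have hd : ∀ᶠ t : ℝ in 𝓝 0,
      HasDerivAt (fun s : ℝ => f (x + s • v)) (fderiv ℝ f (x + t • v) v) t := by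
    filter_upwards [hlim.eventually hf] with t ht
    exact ht.hasFDerivAt.comp_hasDerivAt t (hline t)
  have hdd : HasDerivAt (fun t : ℝ => fderiv ℝ f (x + t • v) v)
      (fderiv ℝ (fderiv ℝ f) x v v) 0 := by
    have h : HasFDerivAt (fderiv ℝ f) (fderiv ℝ (fderiv ℝ f) x) (x + (0 : ℝ) • v) := by
      simpa using hf2.hasFDerivAt
    have h' : HasDerivAt (fun t : ℝ => fderiv ℝ f (x + t • v)) (fderiv ℝ (fderiv ℝ f) x v) 0 :=
      h.comp_hasDerivAt (0 : ℝ) (hline 0)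
    have happly := (ContinuousLinearMap.apply ℝ ℝ v).hasFDerivAt (x := fderiv ℝ f (x + (0 : ℝ) • v))
    exact happly.comp_hasDerivAt (0 : ℝ) h'
  have hslope : Tendsto (fun t : ℝ => fderiv ℝ f (x + t • v) v / (2 * t)) (𝓝[>] 0)
      (𝓝 (fderiv ℝ (fderiv ℝ f) x v v / 2)) := by
    refine (((hasDerivAt_iff_tendsto_slope_zero.1 hdd).mono_left
      (nhdsWithin_mono _ fun t ht => ne_of_gt ht)).div_const 2).congr fun t => ?_
    simp [hf']
    ring
  refine HasDerivAt.lhopital_zero_nhdsGT (hd.filter_mono nhdsWithin_le_nhds)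
    (g' := fun t => 2 * t) ?_ ?_ ?_ ?_ hslope
  · exact Eventually.of_forall fun t => by simpa using hasDerivAt_pow 2 t
  · filter_upwards [self_mem_nhdsWithin] with t ht
    exact mul_ne_zero two_ne_zero (ne_of_gt ht)
  · have h := hd.self_of_nhds.continuousAt.tendsto
    simp only [zero_smul, add_zero, hfx] at h
    exact h.mono_left nhdsWithin_le_nhds
  · have h : ContinuousAt (fun t : ℝ => t ^ 2) 0 := by fun_prop
    simpa using h.tendsto.mono_left (nhdsWithin_le_nhds (s := Set.Ioi 0))

/-- If `W ≥ c·dist²(·, SO(d))` near the identity, `W(Id) = 0` and `W` is twice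
differentiable at the identity, then the tensor of elastic constants `ℂ_W = ∂²W(Id)` is coercive
on symmetric matrices: `ℂ_W[F,F] ≥ c'·|sym F|²` for some `c' > 0`. -/
theorem elastic_tensor_coercive
    (d : ℕ) (hd : 1 ≤ d) (c : ℝ) (hc : 0 < c)
    (W : Matrix (Fin d) (Fin d) ℝ → ℝ)
    (hWnonneg : ∀ F, 0 ≤ W F)
    (hWlb : ∀ᶠ F in 𝓝 (1 : Matrix (Fin d) (Fin d) ℝ),
      c * (Metric.infDist F {Q : Matrix (Fin d) (Fin d) ℝ | Qᵀ * Q = 1 ∧ Q.det = 1}) ^ 2 ≤ W F)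
    (hW1 : W 1 = 0)
    (hdiff : ∀ᶠ F in 𝓝 (1 : Matrix (Fin d) (Fin d) ℝ), DifferentiableAt ℝ W F)
    (hdiff2 : DifferentiableAt ℝ (fderiv ℝ W) (1 : Matrix (Fin d) (Fin d) ℝ)) :
    ∃ c' > (0 : ℝ), ∀ F : Matrix (Fin d) (Fin d) ℝ,
      c' * ‖(1 / 2 : ℝ) • (F + Fᵀ)‖ ^ 2 ≤ fderiv ℝ (fderiv ℝ W) 1 F F := by
  have hcrit : fderiv ℝ W 1 = 0 :=
    IsLocalMin.fderiv_eq_zero (Eventually.of_forall fun F => by simpa [hW1] using hWnonneg F)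
  have hn : 0 < ‖(1 : Matrix (Fin d) (Fin d) ℝ)‖ := by
    have : Nonempty (Fin d) := ⟨⟨0, hd⟩⟩
    exact norm_pos_iff.2 one_ne_zero
  set n := ‖(1 : Matrix (Fin d) (Fin d) ℝ)‖
  refine ⟨2 * c / n ^ 2, by positivity, fun F => ?_⟩
  have hray : Continuous fun t : ℝ => (1 : Matrix (Fin d) (Fin d) ℝ) + t • F := by fun_prop
  have hlim : Tendsto (fun t : ℝ => (1 : Matrix (Fin d) (Fin d) ℝ) + t • F) (𝓝[>] 0) (𝓝 1) := by
    have h := hray.tendsto 0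
    simp only [zero_smul, add_zero] at h
    exact h.mono_left nhdsWithin_le_nhds
  have hbound : ∀ᶠ t : ℝ in 𝓝[>] 0,
      c * (‖F + Fᵀ + t • (Fᵀ * F)‖ / (‖1 + t • F‖ + n)) ^ 2 ≤ W (1 + t • F) / t ^ 2 := by
    filter_upwards [hlim.eventually hWlb, self_mem_nhdsWithin] with t hW ht
    have ht : 0 < t := ht
    have hstrain : (1 + t • F)ᵀ * (1 + t • F) - 1 = t • (F + Fᵀ + t • (Fᵀ * F)) := by
      simp only [Matrix.transpose_add, Matrix.transpose_one, Matrix.transpose_smul,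
        Matrix.add_mul, Matrix.mul_add, Matrix.one_mul, Matrix.mul_one, Matrix.smul_mul,
        Matrix.mul_smul, smul_add]
      abel
    have h := norm_transpose_mul_self_sub_one_le (1 + t • F)
    rw [hstrain, norm_smul, Real.norm_of_nonneg ht.le] at h
    have hpos : 0 < ‖1 + t • F‖ + n := by positivity
    rw [le_div_iff₀ (by positivity), mul_assoc, ← mul_pow]
    refine le_trans ?_ hW
    gcongr
    rw [div_mul_eq_mul_div, div_le_iff₀' hpos, mul_comm]
    exact h
  have hleft : Tendsto (fun t : ℝ => c * (‖F + Fᵀ + t • (Fᵀ * F)‖ / (‖1 + t • F‖ + n)) ^ 2)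
      (𝓝[>] 0) (𝓝 (c * (‖F + Fᵀ‖ / (n + n)) ^ 2)) := by
    have hnum : Continuous fun t : ℝ => ‖F + Fᵀ + t • (Fᵀ * F)‖ := by fun_prop
    have h := (((hnum.tendsto 0).div ((hray.norm.add_const n).tendsto 0)
      (by positivity)).pow 2).const_mul c
    simp only [zero_smul, add_zero] at h
    exact h.mono_left nhdsWithin_le_nhds
  have h := le_of_tendsto_of_tendsto hleft
    (tendsto_div_sq_of_fderiv_eq_zero hW1 hcrit hdiff hdiff2 F) hbound
  rw [norm_smul, Real.norm_of_nonneg (by norm_num)]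
  calc 2 * c / n ^ 2 * (1 / 2 * ‖F + Fᵀ‖) ^ 2 = 2 * (c * (‖F + Fᵀ‖ / (n + n)) ^ 2) := by
        field_simp
        ring
    _ ≤ fderiv ℝ (fderiv ℝ W) 1 F F := (le_div_iff₀' two_pos).1 h
end

section
/- Refined Arzelà–Ascoli theorem along a sequence of metrics: Let S be a set equipped with metrics D_n (n ∈ ℕ) and D, and let σ be a Hausdorff topology on S which is weaker than the topology induced by each of D_n and D, and which is compatible with the metrics in the sense that u_n →σ u and v_n →σ v imply liminf_{n→∞} D_n(u_n, v_n) ≥ D(u, v). Let T > 0, let K ⊆ S be σ-sequentially compact, and let u_n : [0,T] → S be curves with u_n(t) ∈ K for all n ∈ ℕ and t ∈ [0,T], satisfying limsup_{n→∞} D_n(u_n(s), u_n(t)) ≤ ω(s,t) for all s,t ∈ [0,T], where ω : [0,T]² → [0,∞) is symmetric and satisfies lim_{(s,t)→(r,r)} ω(s,t) = 0 for every r ∈ [0,T] ∖ 𝒞, with 𝒞 an at most countable subset of [0,T]. Then there exist a subsequence (not relabeled) and a limiting curve u : [0,T] → S such that u_n(t) →σ u(t) for all t ∈ [0,T] and u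 is continuous with respect to D at every point of [0,T] ∖ 𝒞. -/
open Filter Set Topology

/-- A distance function on a set satisfying the axioms of a metric. -/
def IsMetricDist {S : Type*} (d : S → S → ℝ) : Prop :=
  (∀ x, d x x = 0) ∧ (∀ x y, 0 ≤ d x y) ∧ (∀ x y, d x y = d y x) ∧
  (∀ x y z, d x z ≤ d x y + d y z) ∧ (∀ x y, d x y = 0 → x = y)

/-- In a sequentially compact set, countably many sequences admit a common subsequence along which
they all converge. -/
theorem IsSeqCompact.exists_common_subseq_tendsto {X ι : Type*} [TopologicalSpace X] [Countable ι]
    {K : Set X} (hK : IsSeqCompact K) (f : ι → ℕ → X) (hf : ∀ i n, f i n ∈ K) :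
    ∃ φ : ℕ → ℕ, StrictMono φ ∧ ∀ i, ∃ x ∈ K, Tendsto (f i ∘ φ) atTop (𝓝 x) := by
  rcases isEmpty_or_nonempty ι with _ | _
  · exact ⟨id, strictMono_id, isEmptyElim⟩
  obtain ⟨e, he⟩ := exists_surjective_nat ι
  have refine_subseq : ∀ (ψ : ℕ → ℕ) (i : ι), ∃ θ : ℕ → ℕ, StrictMono θ ∧
      ∃ x ∈ K, Tendsto (f i ∘ ψ ∘ θ) atTop (𝓝 x) := fun ψ i ↦ by
    obtain ⟨x, hx, θ, hθ, h⟩ := hK (x := f i ∘ ψ) fun n ↦ hf i _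
    exact ⟨θ, hθ, x, hx, h⟩
  choose θ hθ hlim using refine_subseq
  let ψ : ℕ → ℕ → ℕ := fun n ↦ Nat.rec (motive := fun _ ↦ ℕ → ℕ) id (fun m χ ↦ χ ∘ θ χ (e m)) n
  have hψ : ∀ n, ψ (n + 1) = ψ n ∘ θ (ψ n) (e n) := fun _ ↦ rfl
  let F : ℕ → Filter ℕ := fun n ↦ map (ψ n) atTop
  have hF : Antitone F := antitone_nat_of_succ_le fun n ↦ by
    simp only [F, hψ, ← Filter.map_map]
    exact map_mono (hθ _ _).tendsto_atTop
  have hF_neBot : ∀ n, (F n).NeBot := fun n ↦ map_neBot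
  have : (⨅ n, F n).NeBot := iInf_neBot_of_directed hF.directed_ge hF_neBot
  obtain ⟨g, hg⟩ := exists_seq_tendsto (⨅ n, F n)
  have hF_zero : F 0 = atTop := map_id
  obtain ⟨χ, hχ, hgχ_mono⟩ := strictMono_subseq_of_tendsto_atTop
    (hg.mono_right ((iInf_le F 0).trans hF_zero.le))
  have hgχ : Tendsto (g ∘ χ) atTop (⨅ n, F n) := hg.comp hχ.tendsto_atTop
  refine ⟨g ∘ χ, hgχ_mono, fun i ↦ ?_⟩
  obtain ⟨n, rfl⟩ := he i
  obtain ⟨x, hx, h⟩ := hlim (ψ n) (e n)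
  refine ⟨x, hx, Tendsto.comp (y := F (n + 1)) ?_ (hgχ.mono_right (iInf_le F (n + 1)))⟩
  rwa [tendsto_map'_iff, hψ]

/-- A convergent subsequence extends to a convergent sequence by filling in its limit. -/
theorem Filter.Tendsto.extend_subseq {X : Type*} [TopologicalSpace X] {f : ℕ → X} {φ : ℕ → ℕ}
    (hφ : StrictMono φ) {x : X} (h : Tendsto (f ∘ φ) atTop (𝓝 x))
    [DecidablePred (· ∈ range φ)] :
    Tendsto (fun n ↦ if n ∈ range φ then f n else x) atTop (𝓝 x) := by
  refine Tendsto.if ?_ tendsto_const_nhds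
  have hcomap : comap φ atTop = atTop := by
    rw [← Nat.cofinite_eq_atTop, hφ.injective.comap_cofinite_eq]
  have hmap : atTop ⊓ 𝓟 {n | n ∈ range φ} = map φ atTop := by
    conv_rhs => rw [← hcomap, Filter.map_comap]
    rfl
  rwa [hmap, tendsto_map'_iff]

/-- Lower semicontinuity of a sequence of distances passes to subsequences. -/
theorem le_of_tendsto_subseq {S : Type*} [TopologicalSpace S] {Dn : ℕ → S → S → ℝ}
    {D : S → S → ℝ}
    (hcompat : ∀ (u v : ℕ → S) (u₀ v₀ : S),
      Tendsto u atTop (𝓝 u₀) → Tendsto v atTop (𝓝 v₀) →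
      ∀ ε > (0 : ℝ), ∀ᶠ n in atTop, D u₀ v₀ - ε < Dn n (u n) (v n))
    {u v : ℕ → S} {c : ℝ} (hc : ∀ ε > (0 : ℝ), ∀ᶠ n in atTop, Dn n (u n) (v n) < c + ε)
    {φ : ℕ → ℕ} (hφ : StrictMono φ) {x y : S}
    (hx : Tendsto (u ∘ φ) atTop (𝓝 x)) (hy : Tendsto (v ∘ φ) atTop (𝓝 y)) : D x y ≤ c := by
  classical
  refine le_of_forall_pos_le_add fun ε hε ↦ ?_
  have hlower := hφ.tendsto_atTop.eventually
    (hcompat _ _ x y (hx.extend_subseq hφ) (hy.extend_subseq hφ) (ε / 2) (half_pos hε))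
  obtain ⟨k, hk, hk'⟩ :=
    (hlower.and (hφ.tendsto_atTop.eventually (hc (ε / 2) (half_pos hε)))).exists
  simp only [mem_range_self, if_true] at hk
  linarith

/-- Refined Arzelà–Ascoli theorem along a sequence of metrics: given metrics
`Dₙ` and `D` on `S`, a weaker Hausdorff topology `σ` compatible with the metrics, a
`σ`-sequentially compact set `K`, and curves `uₙ : [0,T] → K` satisfying
`limsup_n Dₙ(uₙ(s),uₙ(t)) ≤ ω(s,t)` with `ω` symmetric and vanishing near the diagonal off an at
most countable set `𝒞`, a subsequence of `(uₙ)` converges pointwise in `σ` to a limit curve `u`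
which is `D`-continuous on `[0,T] \ 𝒞`. -/
theorem refined_arzela_ascoli
    (S : Type*) (T : ℝ) (hT : 0 < T)
    (Dn : ℕ → S → S → ℝ) (D : S → S → ℝ)
    (hDn : ∀ n, IsMetricDist (Dn n)) (hD : IsMetricDist D)
    (σ : TopologicalSpace S) (hT2 : @T2Space S σ)
    (hweakn : ∀ n (v : ℕ → S) (x : S),
      Tendsto (fun k => Dn n (v k) x) atTop (𝓝 0) → Tendsto v atTop (@nhds S σ x))
    (hweak : ∀ (v : ℕ → S) (x : S),
      Tendsto (fun k => D (v k) x) atTop (𝓝 0) → Tendsto v atTop (@nhds S σ x))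
    (hcompat : ∀ (u v : ℕ → S) (u₀ v₀ : S),
      Tendsto u atTop (@nhds S σ u₀) → Tendsto v atTop (@nhds S σ v₀) →
      ∀ ε > (0 : ℝ), ∀ᶠ n in atTop, D u₀ v₀ - ε < Dn n (u n) (v n))
    (K : Set S)
    (hK : ∀ v : ℕ → S, (∀ n, v n ∈ K) → ∃ x ∈ K, ∃ ψ : ℕ → ℕ, StrictMono ψ ∧
      Tendsto (v ∘ ψ) atTop (@nhds S σ x))
    (un : ℕ → ℝ → S) (hun : ∀ n, ∀ t ∈ Icc (0 : ℝ) T, un n t ∈ K)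
    (ω : ℝ → ℝ → ℝ)
    (hωnonneg : ∀ s t, 0 ≤ ω s t) (hωsymm : ∀ s t, ω s t = ω t s)
    (𝒞 : Set ℝ) (h𝒞 : 𝒞.Countable)
    (hω : ∀ r ∈ Icc (0 : ℝ) T \ 𝒞,
      Tendsto (fun p : ℝ × ℝ => ω p.1 p.2) (𝓝[(Icc (0 : ℝ) T) ×ˢ (Icc (0 : ℝ) T)] (r, r))
        (𝓝 0))
    (hlimsup : ∀ s ∈ Icc (0 : ℝ) T, ∀ t ∈ Icc (0 : ℝ) T, ∀ ε > (0 : ℝ),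
      ∀ᶠ n in atTop, Dn n (un n s) (un n t) < ω s t + ε) :
    ∃ ψ : ℕ → ℕ, StrictMono ψ ∧ ∃ u : ℝ → S,
      (∀ t ∈ Icc (0 : ℝ) T, Tendsto (fun k => un (ψ k) t) atTop (@nhds S σ (u t))) ∧
      ∀ r ∈ Icc (0 : ℝ) T \ 𝒞, ∀ ε > (0 : ℝ), ∃ δ > (0 : ℝ),
        ∀ t ∈ Icc (0 : ℝ) T, |t - r| < δ → D (u t) (u r) < ε := by
  have hK' : IsSeqCompact K := fun v hv ↦ hK v hv
  obtain ⟨Q, hQI, hQ, hQdense⟩ :=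
    (TopologicalSpace.IsSeparable.of_separableSpace (Icc 0 T)).exists_countable_dense_subset
  let A : Set ℝ := Q ∪ 𝒞 ∩ Icc 0 T
  have hAI : A ⊆ Icc 0 T := union_subset hQI inter_subset_right
  have : Countable A := (hQ.union (h𝒞.mono inter_subset_left)).to_subtype
  obtain ⟨ψ, hψ, hA⟩ := hK'.exists_common_subseq_tendsto (fun (t : A) n ↦ un n t)
    fun t n ↦ hun n t (hAI t.2)
  have hdist : ∀ φ : ℕ → ℕ, StrictMono φ → ∀ s ∈ Icc 0 T, ∀ t ∈ Icc 0 T, ∀ x y,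
      Tendsto (fun k ↦ un (φ k) s) atTop (𝓝 x) → Tendsto (fun k ↦ un (φ k) t) atTop (𝓝 y) →
      D x y ≤ ω s t := fun φ hφ s hs t ht x y hx hy ↦
    le_of_tendsto_subseq hcompat (hlimsup s hs t ht) hφ hx hy
  have hsmall : ∀ t ∈ Icc 0 T \ 𝒞, ∀ ε > 0, ∀ᶠ s in 𝓝[Icc 0 T] t, ω s t < ε := by
    intro t ht ε hε
    have hslice : Tendsto (fun s : ℝ ↦ (s, t)) (𝓝[Icc 0 T] t) (𝓝[Icc 0 T ×ˢ Icc 0 T] (t, t)) :=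
      (Continuous.prodMk_left t).continuousWithinAt.tendsto_nhdsWithin fun s hs ↦ ⟨hs, ht.1⟩
    exact ((hω t ht).comp hslice).eventually (gt_mem_nhds hε)
  have hconv : ∀ t ∈ Icc 0 T, ∃ x, Tendsto (fun k ↦ un (ψ k) t) atTop (𝓝 x) := by
    intro t ht
    by_cases htA : t ∈ A
    · obtain ⟨x, -, hx⟩ := hA ⟨t, htA⟩
      exact ⟨x, hx⟩
    have ht𝒞 : t ∈ Icc 0 T \ 𝒞 := ⟨ht, fun h ↦ htA (Or.inr ⟨h, ht⟩)⟩
    obtain ⟨x, -, θ, hθ, hx⟩ := hK (fun k ↦ un (ψ k) t) fun k ↦ hun _ t ht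
    refine ⟨x, tendsto_of_subseq_tendsto fun ns hns ↦ ?_⟩
    obtain ⟨χ, hχ, hnsχ⟩ := strictMono_subseq_of_tendsto_atTop hns
    obtain ⟨y, -, η, hη, hy⟩ := hK (fun k ↦ un (ψ (ns (χ k))) t) fun k ↦ hun _ t ht
    suffices y = x from ⟨χ ∘ η, this ▸ hy⟩
    obtain ⟨-, hDnonneg, hDsymm, hDtri, hDeq⟩ := hD
    refine hDeq y x (le_antisymm (le_of_forall_pos_le_add fun ε hε ↦ ?_) (hDnonneg y x))
    have : (𝓝[A] t).NeBot :=
      mem_closure_iff_nhdsWithin_neBot.1 (closure_mono subset_union_left (hQdense ht))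
    obtain ⟨s, hs, hsA⟩ := (((hsmall t ht𝒞 (ε / 2) (half_pos hε)).filter_mono
      (nhdsWithin_mono t hAI)).and self_mem_nhdsWithin).exists
    obtain ⟨z, -, hz⟩ := hA ⟨s, hsA⟩
    have hzx := hdist _ (hψ.comp hθ) s (hAI hsA) t ht z x (hz.comp hθ.tendsto_atTop) hx
    have hnsχη := hnsχ.comp hη
    have hzy := hdist _ (hψ.comp hnsχη) s (hAI hsA) t ht z y (hz.comp hnsχη.tendsto_atTop) hy
    have htri := hDtri y z x
    rw [hDsymm y z] at htri
    linarith
  have : Nonempty S := ⟨un 0 0⟩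
  choose! u hu using hconv
  refine ⟨ψ, hψ, u, hu, fun r hr ε hε ↦ ?_⟩
  obtain ⟨δ, hδ, h⟩ := Metric.mem_nhdsWithin_iff.1 (hsmall r hr ε hε)
  exact ⟨δ, hδ, fun t ht htr ↦ (hdist ψ hψ t ht r hr.1 _ _ (hu t ht) (hu r hr.1)).trans_lt
    (h ⟨htr, ht⟩)⟩
end

section
/- Let d ≥ 1. For every F ∈ ℝ^{d×d} one has lim_{t→0} dist(Id + tF, SO(d)) / |t| = |sym(F)|, where sym(F) := (F + Fᵀ)/2, dist(G, SO(d)) = inf_{Q ∈ SO(d)} |G − Q|, and |·| is the Frobenius norm. In particular, there exists C > 0 (depending on F) such that dist(Id + tF, SO(d)) ≥ |t|·|sym(F)| − C t² for all sufficiently small t. -/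
open Matrix Filter Topology

attribute [local instance] Matrix.frobeniusNormedAddCommGroup Matrix.frobeniusNormedSpace

/-- The exponential of a real skew-symmetric matrix is a rotation. -/
theorem exp_mem_rotations_of_transpose_eq_neg {n : Type*} [Fintype n] [DecidableEq n]
    {W : Matrix n n ℝ} (hW : Wᵀ = -W) :
    (NormedSpace.exp W)ᵀ * NormedSpace.exp W = 1 ∧ (NormedSpace.exp W).det = 1 := by
  have orth : ∀ V : Matrix n n ℝ, Vᵀ = -V →
      (NormedSpace.exp V)ᵀ * NormedSpace.exp V = 1 := by
    intro V hV
    rw [← Matrix.exp_transpose, hV, Matrix.exp_neg]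
    exact Matrix.nonsing_inv_mul _
      ((Matrix.isUnit_iff_isUnit_det _).mp (Matrix.isUnit_exp V))
  refine ⟨orth W hW, ?_⟩
  have half := orth ((1 / 2 : ℝ) • W) (by rw [Matrix.transpose_smul, hW, smul_neg])
  have hdet := congrArg Matrix.det half
  rw [Matrix.det_mul, Matrix.det_transpose, Matrix.det_one] at hdet
  have hsplit : W = 2 • ((1 / 2 : ℝ) • W) := by
    ext i j
    simp
  rw [hsplit, Matrix.exp_nsmul, Matrix.det_pow, pow_two, hdet]

/-- The symmetric part does not increase the Frobenius norm. -/
theorem norm_sym_le {n : Type*} [Fintype n] (A : Matrix n n ℝ) :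
    ‖(1 / 2 : ℝ) • (A + Aᵀ)‖ ≤ ‖A‖ := by
  have h := norm_add_le A Aᵀ
  rw [Matrix.frobenius_norm_transpose] at h
  rw [norm_smul, Real.norm_of_nonneg (by norm_num)]
  linarith

/-- Near the identity, an orthogonal matrix has quadratically small symmetric displacement. -/
theorem norm_sym_sub_one_le {n : Type*} [Fintype n] [DecidableEq n] {Q : Matrix n n ℝ}
    (hQ : Qᵀ * Q = 1) :
    ‖(1 / 2 : ℝ) • ((Q - 1) + (Q - 1)ᵀ)‖ ≤ ‖Q - 1‖ ^ 2 / 2 := by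
  have key : (Q - 1) + (Q - 1)ᵀ = -((Q - 1)ᵀ * (Q - 1)) := by
    rw [Matrix.transpose_sub, Matrix.transpose_one, Matrix.sub_mul, Matrix.mul_sub, hQ]
    simp only [Matrix.mul_one, Matrix.one_mul]
    abel
  have h := Matrix.frobenius_norm_mul (Q - 1)ᵀ (Q - 1)
  rw [Matrix.frobenius_norm_transpose] at h
  rw [key, norm_smul, norm_neg, Real.norm_of_nonneg (by norm_num)]
  nlinarith

theorem le_infDist_rotations {n : Type*} [Fintype n] [DecidableEq n] (F : Matrix n n ℝ) (t : ℝ) :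
    |t| * ‖(1 / 2 : ℝ) • (F + Fᵀ)‖ - 2 * ‖F‖ ^ 2 * t ^ 2
      ≤ Metric.infDist ((1 : Matrix n n ℝ) + t • F)
          {Q : Matrix n n ℝ | Qᵀ * Q = 1 ∧ Q.det = 1} := by
  refine (Metric.le_infDist ⟨1, by simp⟩).2 ?_
  rintro Q ⟨hQ, -⟩
  rw [dist_eq_norm]
  have htF : ‖t • F‖ = |t| * ‖F‖ := by rw [norm_smul, Real.norm_eq_abs]
  rcases le_total (|t| * ‖F‖) ‖1 + t • F - Q‖ with h | h
  · have := mul_le_mul_of_nonneg_left (norm_sym_le F) (abs_nonneg t)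
    nlinarith [mul_nonneg (sq_nonneg ‖F‖) (sq_nonneg t)]
  · have hA : ‖Q - 1‖ ≤ 2 * (|t| * ‖F‖) := by
      have := norm_sub_le (t • F) (1 + t • F - Q)
      rw [show t • F - (1 + t • F - Q) = Q - 1 by abel] at this
      linarith
    have hA2 : ‖Q - 1‖ ^ 2 ≤ 4 * (‖F‖ ^ 2 * t ^ 2) := by
      have := pow_le_pow_left₀ (norm_nonneg _) hA 2
      rw [mul_pow, mul_pow, sq_abs] at this
      linarith
    have h1 := norm_sym_sub_one_le hQ
    have h2 := norm_sym_le (1 + t • F - Q)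
    have h3 := norm_add_le ((1 / 2 : ℝ) • ((1 + t • F - Q) + (1 + t • F - Q)ᵀ))
      ((1 / 2 : ℝ) • ((Q - 1) + (Q - 1)ᵀ))
    have h4 : (1 / 2 : ℝ) • ((1 + t • F - Q) + (1 + t • F - Q)ᵀ)
        + (1 / 2 : ℝ) • ((Q - 1) + (Q - 1)ᵀ) = t • ((1 / 2 : ℝ) • (F + Fᵀ)) := by
      ext i j
      simp only [Matrix.add_apply, Matrix.sub_apply, Matrix.smul_apply, Matrix.transpose_apply,
        smul_eq_mul]
      ring
    rw [h4, norm_smul t, Real.norm_eq_abs] at h3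
    linarith

theorem tendsto_slope_exp_smul {n : Type*} [Fintype n] [DecidableEq n] (W : Matrix n n ℝ) :
    Tendsto (fun t : ℝ => t⁻¹ • (NormedSpace.exp (t • W) - 1)) (𝓝[≠] 0) (𝓝 W) := by
  let _ : NormedRing (Matrix n n ℝ) := Matrix.frobeniusNormedRing
  let _ : NormedAlgebra ℝ (Matrix n n ℝ) := Matrix.frobeniusNormedAlgebra
  have h := (hasDerivAt_exp_smul_const W (0 : ℝ)).tendsto_slope_zero
  simp only [zero_add, zero_smul, NormedSpace.exp_zero, one_mul] at h
  exact h

/-- First order expansion of the distance to `SO(d)`: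
`lim_{t→0} dist(Id + tF, SO(d))/|t| = |sym F|`; in particular there is `C > 0` with
`dist(Id + tF, SO(d)) ≥ |t|·|sym F| − C t²` for all small `t`. -/
theorem dist_to_rotations_expansion
    (d : ℕ) (hd : 1 ≤ d)
    (F : Matrix (Fin d) (Fin d) ℝ) :
    Tendsto
        (fun t : ℝ =>
          Metric.infDist ((1 : Matrix (Fin d) (Fin d) ℝ) + t • F)
              {Q : Matrix (Fin d) (Fin d) ℝ | Qᵀ * Q = 1 ∧ Q.det = 1} / |t|)
        (𝓝[≠] (0 : ℝ)) (𝓝 ‖(1 / 2 : ℝ) • (F + Fᵀ)‖) ∧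
    ∃ C > (0 : ℝ), ∀ᶠ t in 𝓝 (0 : ℝ),
      |t| * ‖(1 / 2 : ℝ) • (F + Fᵀ)‖ - C * t ^ 2
        ≤ Metric.infDist ((1 : Matrix (Fin d) (Fin d) ℝ) + t • F)
            {Q : Matrix (Fin d) (Fin d) ℝ | Qᵀ * Q = 1 ∧ Q.det = 1} := by
  constructor
  · set W : Matrix (Fin d) (Fin d) ℝ := (1 / 2 : ℝ) • (F - Fᵀ) with hWdef
    have hW : Wᵀ = -W := by
      rw [hWdef, Matrix.transpose_smul, Matrix.transpose_sub, Matrix.transpose_transpose,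
        ← smul_neg, neg_sub]
    have hFW : F - W = (1 / 2 : ℝ) • (F + Fᵀ) := by
      ext i j
      simp only [hWdef, Matrix.add_apply, Matrix.sub_apply, Matrix.smul_apply,
        Matrix.transpose_apply, smul_eq_mul]
      ring
    have hlower : Tendsto
        (fun t : ℝ => ‖(1 / 2 : ℝ) • (F + Fᵀ)‖ - 2 * ‖F‖ ^ 2 * |t|) (𝓝[≠] 0)
        (𝓝 ‖(1 / 2 : ℝ) • (F + Fᵀ)‖) := by
      have hc : Continuous
          (fun t : ℝ => ‖(1 / 2 : ℝ) • (F + Fᵀ)‖ - 2 * ‖F‖ ^ 2 * |t|) := by fun_prop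
      simpa using (hc.tendsto 0).mono_left nhdsWithin_le_nhds
    have hupper : Tendsto
        (fun t : ℝ => ‖F - t⁻¹ • (NormedSpace.exp (t • W) - 1)‖) (𝓝[≠] 0)
        (𝓝 ‖(1 / 2 : ℝ) • (F + Fᵀ)‖) := by
      rw [← hFW]
      exact (tendsto_const_nhds.sub (tendsto_slope_exp_smul W)).norm
    refine tendsto_of_tendsto_of_tendsto_of_le_of_le' hlower hupper ?_ ?_
    · filter_upwards [self_mem_nhdsWithin] with t ht
      rw [le_div_iff₀ (abs_pos.2 ht)]
      have h := le_infDist_rotations F t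
      rw [← sq_abs t] at h
      linarith
    · filter_upwards [self_mem_nhdsWithin] with t ht
      have ht0 : t ≠ 0 := ht
      rw [div_le_iff₀ (abs_pos.2 ht0)]
      have hmem : NormedSpace.exp (t • W) ∈
          {Q : Matrix (Fin d) (Fin d) ℝ | Qᵀ * Q = 1 ∧ Q.det = 1} :=
        exp_mem_rotations_of_transpose_eq_neg
          (by rw [Matrix.transpose_smul, hW, smul_neg])
      refine (Metric.infDist_le_dist_of_mem hmem).trans_eq ?_
      rw [dist_eq_norm, mul_comm, ← Real.norm_eq_abs, ← norm_smul, smul_sub,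
        smul_inv_smul₀ ht0]
      congr 1
      abel
  · refine ⟨2 * ‖F‖ ^ 2 + 1, by positivity, Eventually.of_forall fun t => ?_⟩
    have h := le_infDist_rotations F t
    nlinarith [sq_nonneg t]
end
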